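/- arXiv:2410.04481 — 6 statements merged into one kernel-verified Lean document; each statement's English description precedes it below -/
import Mathlib

section
/- Let n ≥ 2 and let K be a configuration on the circle set ZMod n. Then c_K ≤ 4n − 6; equivalently, K contains at most 2n − 3 pairs. -/
open Finset

/-- The cyclic interval `[i,j]` in the circle set `ZMod n`: the set
`{i, i+1, ..., j}` obtained by repeatedly adding `1` starting from `i` until `j` is
reached (both endpoints included). -/
def cycInterval (n : ℕ) (i j : ZMod n) : Set (ZMod n) :=
  {x | ∃ m : ℕ, m ≤ (j - i).val ∧ x = i + (m : ZMod n)}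

/-- A configuration on the circle set `ZMod n`: a finite set of unordered pairs of
distinct elements such that any two pairs `{i,j}`, `{k,l}` of the configuration are
non-crossing, i.e. either `i, j ∈ [k,l]` or `i, j ∈ [l,k]`. -/
def IsConfiguration (n : ℕ) (K : Finset (Sym2 (ZMod n))) : Prop :=
  (∀ p ∈ K, ¬ p.IsDiag) ∧
  ∀ i j k l : ZMod n, s(i, j) ∈ K → s(k, l) ∈ K →
    (i ∈ cycInterval n k l ∧ j ∈ cycInterval n k l) ∨
    (i ∈ cycInterval n l k ∧ j ∈ cycInterval n l k)

/-- `c_K = ∑_{i ∈ ZMod n} #{j ∈ ZMod n | {i,j} ∈ K}`. -/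
def cConfig (n : ℕ) [NeZero n] (K : Finset (Sym2 (ZMod n))) : ℕ :=
  ∑ i : ZMod n, (Finset.univ.filter fun j : ZMod n => s(i, j) ∈ K).card

/-- A finite set of pairwise non-crossing arcs `x < y` on the line has at most `2 * m - 1` arcs
contained in an interval of length `m ≥ 1`. -/
theorem card_noncrossing_arcs_le (S : Finset (ℕ × ℕ)) (hlt : ∀ p ∈ S, p.1 < p.2)
    (hS : ∀ p ∈ S, ∀ q ∈ S, p.1 < q.1 → q.1 < p.2 → p.2 < q.2 → False)
    (m : ℕ) (hm : 1 ≤ m) (a : ℕ) :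
    #{p ∈ S | a ≤ p.1 ∧ p.2 ≤ a + m} ≤ 2 * m - 1 := by
  induction m using Nat.strong_induction_on generalizing a with
  | _ m ih =>
  rcases Nat.eq_or_lt_of_le hm with rfl | hm2
  · refine (card_le_card (t := {(a, a + 1)}) ?_).trans (by simp)
    rintro ⟨x, y⟩ hp
    have hxy := hlt _ (mem_filter.1 hp).1
    simp only [mem_filter, mem_singleton, Prod.mk.injEq] at *
    omega
  · -- split at the far end `a + c` of the longest proper arc starting at `a`
    obtain ⟨c, hc, hmax⟩ := exists_max_image
      {c ∈ Ico 1 m | c = 1 ∨ (a, a + c) ∈ S} id ⟨1, by simp [hm2]⟩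
    simp only [mem_filter, mem_Ico, id] at hc hmax
    have hsub : {p ∈ S | a ≤ p.1 ∧ p.2 ≤ a + m} ⊆
        insert (a, a + m) ({p ∈ S | a ≤ p.1 ∧ p.2 ≤ a + c} ∪
          {p ∈ S | a + c ≤ p.1 ∧ p.2 ≤ a + c + (m - c)}) := by
      rintro ⟨x, y⟩ hp
      obtain ⟨hp, hx, hy⟩ := mem_filter.1 hp
      have hxy := hlt _ hp
      simp only [mem_insert, mem_union, mem_filter, hp, true_and, Prod.mk.injEq] at hx hy hxy ⊢
      by_contra! hcon
      have hlong : x = a → ¬ y < a + m := by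
        rintro rfl hym
        have := hmax (y - x) ⟨by omega, Or.inr (by rwa [Nat.add_sub_cancel' hxy.le])⟩
        omega
      rcases hc.2 with h1 | h1
      · omega
      · have hcross : ¬ (a < x ∧ x < a + c ∧ a + c < y) := fun h =>
          hS _ h1 _ hp h.1 h.2.1 h.2.2
        omega
    have h1 := ih c (by omega) (by omega) a
    have h2 := ih (m - c) (by omega) (by omega) (a + c)
    have h3 := card_le_card hsub
    have h4 := card_insert_le (a, a + m) ({p ∈ S | a ≤ p.1 ∧ p.2 ≤ a + c} ∪
          {p ∈ S | a + c ≤ p.1 ∧ p.2 ≤ a + c + (m - c)})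
    have h5 := card_union_le {p ∈ S | a ≤ p.1 ∧ p.2 ≤ a + c}
          {p ∈ S | a + c ≤ p.1 ∧ p.2 ≤ a + c + (m - c)}
    omega

theorem val_le_of_mem_cycInterval {n : ℕ} [NeZero n] {x c d : ZMod n} (hcd : c.val ≤ d.val)
    (hx : x ∈ cycInterval n c d) : c.val ≤ x.val := by
  obtain ⟨m, hm, rfl⟩ := hx
  rw [ZMod.val_sub hcd] at hm
  have hd := d.val_lt
  have hmn : (m : ZMod n).val = m := ZMod.val_cast_of_lt (by omega)
  rw [ZMod.val_add_of_lt] <;> omega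

theorem val_le_or_le_of_mem_cycInterval {n : ℕ} [NeZero n] {x c d : ZMod n}
    (hcd : c.val < d.val) (hx : x ∈ cycInterval n d c) : x.val ≤ c.val ∨ d.val ≤ x.val := by
  obtain ⟨m, hm, rfl⟩ := hx
  have hd := d.val_lt
  have hne : d - c ≠ 0 := sub_ne_zero.2 fun h => by simp [h] at hcd
  have : NeZero (d - c) := ⟨hne⟩
  rw [← neg_sub, ZMod.val_neg_of_ne_zero, ZMod.val_sub hcd.le] at hm
  have hmn : (m : ZMod n).val = m := ZMod.val_cast_of_lt (by omega)
  rcases lt_or_ge (d.val + m) n with h | h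
  · right
    rw [ZMod.val_add_of_lt] <;> omega
  · left
    have := ZMod.val_add_val_of_le (a := d) (b := (m : ZMod n)) (by omega)
    omega

theorem IsConfiguration.not_crossing {n : ℕ} [NeZero n] {K : Finset (Sym2 (ZMod n))}
    (hK : IsConfiguration n K) {a b c d : ZMod n} (hab : s(a, b) ∈ K) (hcd : s(c, d) ∈ K)
    (h1 : a.val < c.val) (h2 : c.val < b.val) (h3 : b.val < d.val) : False := by
  rcases hK.2 a b c d hab hcd with ⟨h, -⟩ | ⟨-, h⟩
  · have := val_le_of_mem_cycInterval (by omega) h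
    omega
  · have := val_le_or_le_of_mem_cycInterval (by omega) h
    omega

theorem IsConfiguration.card_le {n : ℕ} [NeZero n] (hn : 2 ≤ n) {K : Finset (Sym2 (ZMod n))}
    (hK : IsConfiguration n K) : #K ≤ 2 * n - 3 := by
  let T : Finset (ZMod n × ZMod n) := {p | p.1.val < p.2.val ∧ s(p.1, p.2) ∈ K}
  let f : ZMod n × ZMod n → ℕ × ℕ := Prod.map ZMod.val ZMod.val
  have hf : Function.Injective f := (ZMod.val_injective n).prodMap (ZMod.val_injective n)
  have hKT : K ⊆ T.image fun p => s(p.1, p.2) := by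
    intro e he
    induction e with
    | _ x y =>
      have hne : x ≠ y := hK.1 _ he
      rcases lt_or_gt_of_ne ((ZMod.val_injective n).ne hne) with h | h
      · exact mem_image.2 ⟨(x, y), by simp [T, h, he], rfl⟩
      · exact mem_image.2 ⟨(y, x), by simp [T, h, Sym2.eq_swap, he], Sym2.eq_swap⟩
  have harcs := card_noncrossing_arcs_le (T.image f)
    (by
      simp only [mem_image, forall_exists_index, and_imp]
      rintro _ p hp rfl
      exact (mem_filter.1 hp).2.1)
    (by
      simp only [mem_image, forall_exists_index, and_imp]
      rintro _ p hp rfl _ q hq rfl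
      exact hK.not_crossing (mem_filter.1 hp).2.2 (mem_filter.1 hq).2.2)
    (n - 1) (by omega) 0
  rw [filter_true_of_mem, card_image_of_injective _ hf] at harcs
  · have := (card_le_card hKT).trans card_image_le
    omega
  · simp only [mem_image, forall_exists_index, and_imp]
    rintro _ p - rfl
    have := p.2.val_lt
    simp only [f, Prod.map]
    omega

theorem cConfig_le_two_mul_card (n : ℕ) [NeZero n] (K : Finset (Sym2 (ZMod n))) :
    cConfig n K ≤ 2 * #K := by
  have hsum : cConfig n K = #{p : ZMod n × ZMod n | s(p.1, p.2) ∈ K} := by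
    simp only [cConfig, card_filter, Fintype.sum_prod_type]
  rw [hsum]
  refine card_le_mul_card_image_of_maps_to (f := fun p : ZMod n × ZMod n => s(p.1, p.2))
    (fun p hp => (mem_filter.1 hp).2) 2 fun e _ => ?_
  induction e with
  | _ x y =>
    refine (card_le_card (t := {(x, y), (y, x)}) ?_).trans card_le_two
    rintro ⟨u, v⟩ hp
    simpa using (mem_filter.1 hp).2

/-- For `n ≥ 2` and `K` a configuration on the circle set `ZMod n`, one has
`c_K ≤ 4n - 6`; equivalently, `K` contains at most `2n - 3` pairs. -/
theorem configuration_cK_le (n : ℕ) [NeZero n] (hn : 2 ≤ n)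
    (K : Finset (Sym2 (ZMod n))) (hK : IsConfiguration n K) :
    cConfig n K ≤ 4 * n - 6 ∧ K.card ≤ 2 * n - 3 := by
  have hcard := hK.card_le hn
  have hsum := cConfig_le_two_mul_card n K
  omega
end

section
/- Let n ≥ 2. The number of configurations on the circle set ZMod n is at most (80e)^n, where e is Euler's number. -/
open Finset

/-- A finite set of pairs `(a, b)` of `Fin n` with `a < b`, no two of which cross. -/
def IsNoncrossing {n : ℕ} (E : Finset (Fin n × Fin n)) : Prop :=
  (∀ p ∈ E, p.1 < p.2) ∧
  ∀ p ∈ E, ∀ q ∈ E, p.1 < q.1 → q.1 < p.2 → ¬ p.2 < q.2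

/-- Every pair of a noncrossing set is the longest one at its left endpoint or the longest one
at its right endpoint, so there are at most `2 * n` of them. -/
theorem IsNoncrossing.card_le {n : ℕ} {E : Finset (Fin n × Fin n)} (hE : IsNoncrossing E) :
    E.card ≤ 2 * n := by
  classical
  have h₁ : #{p ∈ E | ∀ q ∈ E, q.1 = p.1 → q.2 ≤ p.2} ≤ n := by
    refine (Finset.card_le_card_of_injOn (t := (univ : Finset (Fin n))) Prod.fst
      (fun _ _ => mem_coe.2 (mem_univ _)) (by
        intro p hp q hq hpq
        rw [mem_coe, mem_filter] at hp hq
        exact Prod.ext hpq (le_antisymm (hq.2 p hp.1 hpq) (hp.2 q hq.1 hpq.symm)))).trans_eq (by simp)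
  have h₂ : #{p ∈ E | ¬ ∀ q ∈ E, q.1 = p.1 → q.2 ≤ p.2} ≤ n := by
    have key : ∀ p ∈ E, ∀ q ∈ E, (¬ ∀ r ∈ E, r.1 = q.1 → r.2 ≤ q.2) → p.2 = q.2 →
        ¬ p.1 < q.1 := by
      intro p hp q hq h hpq hlt
      push Not at h
      obtain ⟨r, hr, hrq, hlt'⟩ := h
      refine hE.2 p hp r hr (hrq ▸ hlt) ?_ (hpq ▸ hlt')
      rw [hrq, hpq]
      exact hE.1 q hq
    refine (Finset.card_le_card_of_injOn (t := (univ : Finset (Fin n))) Prod.snd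
      (fun _ _ => mem_coe.2 (mem_univ _)) (by
        intro p hp q hq hpq
        rw [mem_coe, mem_filter] at hp hq
        exact Prod.ext (le_antisymm (not_lt.1 (key q hq.1 p hp.1 hp.2 hpq.symm))
          (not_lt.1 (key p hp.1 q hq.1 hq.2 hpq))) hpq)).trans_eq (by simp)
  have := Finset.card_filter_add_card_filter_not (s := E)
    (fun p => ∀ q ∈ E, q.1 = p.1 → q.2 ≤ p.2)
  omega

/-- If `f` takes each value equally often on `E` and `E'`, then every element of `E \ E'` has a
counterpart in `E' \ E` with the same value. -/
theorem exists_mem_notMem_of_map_eq {α β : Type*} {E E' : Finset α} {f : α → β}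
    (h : E.val.map f = E'.val.map f) {p : α} (hp : p ∈ E) (hp' : p ∉ E') :
    ∃ q ∈ E', q ∉ E ∧ f q = f p := by
  classical
  by_contra! hq
  have hss : {q ∈ E' | f p = f q} ⊂ {q ∈ E | f p = f q} := by
    refine (Finset.ssubset_iff_of_subset ?_).2 ⟨p, by simp [hp], by simp [hp']⟩
    intro q hq'
    simp only [mem_filter] at hq' ⊢
    exact ⟨by_contra fun hn => hq q hq'.1 hn hq'.2.symm, hq'.2⟩
  have hlt := Finset.card_lt_card hss
  have hcount := congrArg (Multiset.count (f p)) h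
  rw [Multiset.count_map, Multiset.count_map] at hcount
  exact hlt.ne hcount.symm

/-- A noncrossing set is determined by the multisets of its left and of its right endpoints. -/
theorem IsNoncrossing.eq_of_map_eq {n : ℕ} {E E' : Finset (Fin n × Fin n)}
    (hE : IsNoncrossing E) (hE' : IsNoncrossing E')
    (hfst : E.val.map Prod.fst = E'.val.map Prod.fst)
    (hsnd : E.val.map Prod.snd = E'.val.map Prod.snd) : E = E' := by
  have step : ∀ {F F' : Finset (Fin n × Fin n)}, IsNoncrossing F → IsNoncrossing F' →
      F.val.map Prod.fst = F'.val.map Prod.fst → F.val.map Prod.snd = F'.val.map Prod.snd →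
      ∀ p : Fin n × Fin n,
        (∀ q : Fin n × Fin n, (q.2 : ℕ) - q.1 < p.2 - p.1 → (q ∈ F ↔ q ∈ F')) →
        p ∈ F → p ∈ F' := by
    intro F F' hF hF' h₁ h₂ p ih hp
    by_contra hp'
    obtain ⟨q, hq', hq, hqp⟩ := exists_mem_notMem_of_map_eq h₁ hp hp'
    obtain ⟨r, hr', hr, hrp⟩ := exists_mem_notMem_of_map_eq h₂ hp hp'
    have hpl := hF.1 p hp
    have hql := hF'.1 q hq'
    have hrl := hF'.1 r hr'
    have hq₂ : ¬ (q.2 : ℕ) - q.1 < p.2 - p.1 := fun hlt => hq ((ih q hlt).2 hq')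
    have hr₂ : ¬ (r.2 : ℕ) - r.1 < p.2 - p.1 := fun hlt => hr ((ih r hlt).2 hr')
    have hqne : q.2 ≠ p.2 := fun h => hq (Prod.ext hqp h ▸ hp)
    have hrne : r.1 ≠ p.1 := fun h => hr (Prod.ext h hrp ▸ hp)
    refine hF'.2 r hr' q hq' ?_ ?_ ?_ <;> rw [Fin.lt_def] at * <;>
      rw [Fin.ext_iff] at hqp hrp <;> rw [Ne, Fin.ext_iff] at hqne hrne <;> omega
  have main : ∀ d : ℕ, ∀ p : Fin n × Fin n, (p.2 : ℕ) - p.1 = d → (p ∈ E ↔ p ∈ E') := by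
    intro d
    induction d using Nat.strong_induction_on with
    | _ d ih =>
      intro p hd
      exact ⟨step hE hE' hfst hsnd p fun q hq => ih _ (hd ▸ hq) q rfl,
        step hE' hE hfst.symm hsnd.symm p fun q hq => (ih _ (hd ▸ hq) q rfl).symm⟩
  ext p
  exact main _ p rfl

/-- Pad a multiset with at most `k` elements by `none` to one with exactly `k` elements. -/
def padSym {α : Type*} {k : ℕ} (M : Multiset α) (hM : Multiset.card M ≤ k) : Sym (Option α) k :=
  ⟨M.map some + Multiset.replicate (k - Multiset.card M) none, by simp; omega⟩

theorem padSym_inj {α : Type*} {k : ℕ} {M M' : Multiset α} {hM : Multiset.card M ≤ k}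
    {hM' : Multiset.card M' ≤ k} (h : padSym M hM = padSym M' hM') : M = M' := by
  classical
  ext a
  have hcount := congrArg (fun S => Multiset.count (some a) S.1) h
  simpa [padSym, Multiset.count_replicate,
    Multiset.count_map_eq_count' some _ (Option.some_injective α)] using hcount

theorem card_isNoncrossing_le (n : ℕ) :
    Nat.card {E : Finset (Fin n × Fin n) // IsNoncrossing E} ≤ 64 ^ n := by
  let f : {E : Finset (Fin n × Fin n) // IsNoncrossing E} →
      Sym (Option (Fin n)) (2 * n) × Sym (Option (Fin n)) (2 * n) := fun E =>
    (padSym (E.1.val.map Prod.fst) (by simpa using E.2.card_le),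
      padSym (E.1.val.map Prod.snd) (by simpa using E.2.card_le))
  have hf : Function.Injective f := by
    intro E E' h
    obtain ⟨h₁, h₂⟩ := Prod.mk.inj h
    exact Subtype.ext (E.2.eq_of_map_eq E'.2 (padSym_inj h₁) (padSym_inj h₂))
  have hsym : Nat.card (Sym (Option (Fin n)) (2 * n)) ≤ 8 ^ n := by
    rw [Nat.card_eq_fintype_card, Sym.card_sym_eq_choose, Fintype.card_option, Fintype.card_fin]
    calc (n + 1 + 2 * n - 1).choose (2 * n) ≤ 2 ^ (n + 1 + 2 * n - 1) := Nat.choose_le_two_pow _ _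
      _ = 2 ^ (3 * n) := by congr 1; omega
      _ = 8 ^ n := by rw [pow_mul]; norm_num
  calc _ ≤ Nat.card (Sym (Option (Fin n)) (2 * n) × Sym (Option (Fin n)) (2 * n)) :=
        Nat.card_le_card_of_injective f hf
    _ ≤ 8 ^ n * 8 ^ n := by rw [Nat.card_prod]; exact Nat.mul_le_mul hsym hsym
    _ = 64 ^ n := by rw [← mul_pow]; norm_num

theorem val_sub_le_of_mem_cycInterval {n : ℕ} [NeZero n] {i j x : ZMod n}
    (hx : x ∈ cycInterval n i j) : (x - i).val ≤ (j - i).val := by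
  obtain ⟨m, hm, rfl⟩ := hx
  rw [add_sub_cancel_left, ZMod.val_natCast_of_lt (hm.trans_lt (ZMod.val_lt _))]
  exact hm

theorem val_natCast_sub_natCast {n a b : ℕ} (hab : a ≤ b) (hb : b < n) :
    ((b : ZMod n) - (a : ZMod n)).val = b - a := by
  rw [← Nat.cast_sub hab, ZMod.val_natCast_of_lt (by omega)]

theorem val_natCast_sub_natCast_of_lt {n a b : ℕ} (hab : a < b) (hb : b < n) :
    ((a : ZMod n) - (b : ZMod n)).val = n - (b - a) := by
  have h : (a : ZMod n) - (b : ZMod n) = ((n - (b - a) : ℕ) : ZMod n) := by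
    rw [Nat.cast_sub (by omega), Nat.cast_sub hab.le, ZMod.natCast_self]
    ring
  rw [h, ZMod.val_natCast_of_lt (by omega)]

/-- The pairs of `K`, as increasing pairs of elements of `Fin n`. -/
noncomputable def increasingPairs {n : ℕ} (K : Finset (Sym2 (ZMod n))) :
    Finset (Fin n × Fin n) :=
  open Classical in
  {p | p.1 < p.2 ∧ s(((p.1 : ℕ) : ZMod n), ((p.2 : ℕ) : ZMod n)) ∈ K}

theorem mem_increasingPairs {n : ℕ} {K : Finset (Sym2 (ZMod n))} {p : Fin n × Fin n} :
    p ∈ increasingPairs K ↔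
      p.1 < p.2 ∧ s(((p.1 : ℕ) : ZMod n), ((p.2 : ℕ) : ZMod n)) ∈ K := by
  simp [increasingPairs]

theorem IsConfiguration.isNoncrossing {n : ℕ} [NeZero n] {K : Finset (Sym2 (ZMod n))}
    (hK : IsConfiguration n K) : IsNoncrossing (increasingPairs K) := by
  refine ⟨fun p hp => (mem_increasingPairs.1 hp).1, ?_⟩
  rintro ⟨a, b⟩ hp ⟨c, d⟩ hq hac hcb hbd
  simp only [mem_increasingPairs, Fin.lt_def] at hp hq hac hcb hbd
  have hd := d.isLt
  rcases hK.2 _ _ _ _ hq.2 hp.2 with ⟨-, h⟩ | ⟨h, -⟩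
  · have := val_sub_le_of_mem_cycInterval h
    rw [val_natCast_sub_natCast (by omega) (by omega),
      val_natCast_sub_natCast (by omega) (by omega)] at this
    omega
  · have := val_sub_le_of_mem_cycInterval h
    rw [val_natCast_sub_natCast_of_lt (by omega) (by omega),
      val_natCast_sub_natCast_of_lt (by omega) (by omega)] at this
    omega

theorem subset_of_increasingPairs_eq {n : ℕ} [NeZero n] {K K' : Finset (Sym2 (ZMod n))}
    (hK : ∀ p ∈ K, ¬ p.IsDiag) (h : increasingPairs K = increasingPairs K') : K ⊆ K' := by
  have key : ∀ x y : ZMod n, x.val < y.val → s(x, y) ∈ K → s(x, y) ∈ K' := by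
    intro x y hxy hmem
    have hp : ((⟨x.val, x.val_lt⟩, ⟨y.val, y.val_lt⟩) : Fin n × Fin n) ∈ increasingPairs K := by
      simpa [mem_increasingPairs, hxy] using hmem
    rw [h] at hp
    simpa [mem_increasingPairs, hxy] using hp
  intro z hz
  induction z using Sym2.ind with
  | _ x y =>
    have hne : x ≠ y := fun hxy => hK _ hz (by simpa using hxy)
    rcases lt_or_gt_of_ne ((ZMod.val_injective n).ne hne) with hlt | hlt
    · exact key x y hlt hz
    · rw [Sym2.eq_swap] at hz ⊢
      exact key y x hlt hz

/-- For `n ≥ 2`, the number of configurations on the circle set `ZMod n` is at most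
`(80 e)^n`, where `e` is Euler's number. -/
theorem configurations_card_le (n : ℕ) (hn : 2 ≤ n) :
    (Nat.card {K : Finset (Sym2 (ZMod n)) // IsConfiguration n K} : ℝ)
      ≤ (80 * Real.exp 1) ^ n := by
  have : NeZero n := ⟨by omega⟩
  let f : {K : Finset (Sym2 (ZMod n)) // IsConfiguration n K} →
      {E : Finset (Fin n × Fin n) // IsNoncrossing E} := fun K =>
    ⟨increasingPairs K.1, K.2.isNoncrossing⟩
  have hf : Function.Injective f := by
    intro K K' h
    have h' : increasingPairs K.1 = increasingPairs K'.1 := congrArg Subtype.val h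
    exact Subtype.ext (Finset.Subset.antisymm (subset_of_increasingPairs_eq K.2.1 h')
      (subset_of_increasingPairs_eq K'.2.1 h'.symm))
  have hcard := (Nat.card_le_card_of_injective f hf).trans (card_isNoncrossing_le n)
  have hexp : (1 : ℝ) ≤ Real.exp 1 := Real.one_le_exp zero_le_one
  calc (Nat.card {K : Finset (Sym2 (ZMod n)) // IsConfiguration n K} : ℝ) ≤ (64 : ℝ) ^ n := by
        exact_mod_cast hcard
    _ ≤ (80 * Real.exp 1) ^ n := pow_le_pow_left₀ (by norm_num) (by linarith) n
end

section
/- Let n ≥ 3. The set K₀ := {{0, j} : j ∈ ZMod n, j ≠ 0} ∪ {{j, j+1} : j ∈ ZMod n} is a configuration on ZMod n, it has exactly 2n − 3 elements, and hence c_{K₀} = 4n − 6. In particular the bound c_K ≤ 4n − 6 for configurations is attained. -/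
open Finset

/-- The configuration `K₀ = {{0,j} : j ≠ 0} ∪ {{j, j+1} : j ∈ ZMod n}`. -/
def K₀ (n : ℕ) [NeZero n] : Finset (Sym2 (ZMod n)) :=
  ((Finset.univ.filter fun j : ZMod n => j ≠ 0).image fun j => s((0 : ZMod n), j)) ∪
    (Finset.univ.image fun j : ZMod n => s(j, j + 1))

theorem mem_cycInterval_iff {n : ℕ} [NeZero n] {i j x : ZMod n} :
    x ∈ cycInterval n i j ↔ (x - i).val ≤ (j - i).val := by
  constructor
  · rintro ⟨m, hm, rfl⟩
    rw [add_sub_cancel_left, ZMod.val_natCast]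
    exact (Nat.mod_le _ _).trans hm
  · intro h
    exact ⟨(x - i).val, h, by simp⟩

theorem mem_cycInterval_add_one_self {n : ℕ} [NeZero n] (k x : ZMod n) :
    x ∈ cycInterval n (k + 1) k := by
  rw [mem_cycInterval_iff, show k - (k + 1) = -1 by ring]
  obtain _ | m := n
  · exact absurd rfl (NeZero.ne 0)
  · rw [ZMod.val_neg_one]
    exact Nat.le_of_lt_succ (ZMod.val_lt _)

theorem mem_cycInterval_zero_left {n : ℕ} [NeZero n] {l x : ZMod n} :
    x ∈ cycInterval n 0 l ↔ x.val ≤ l.val := by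
  simp [mem_cycInterval_iff]

theorem zero_mem_cycInterval_zero_right {n : ℕ} [NeZero n] (l : ZMod n) :
    0 ∈ cycInterval n l 0 := by
  simp [mem_cycInterval_iff]

theorem mem_cycInterval_zero_right {n : ℕ} [NeZero n] {l x : ZMod n} (hl : l ≠ 0)
    (h : l.val ≤ x.val) : x ∈ cycInterval n l 0 := by
  have : NeZero l := ⟨hl⟩
  rw [mem_cycInterval_iff, ZMod.val_sub h, zero_sub, ZMod.val_neg_of_ne_zero]
  have := ZMod.val_lt x
  omega

theorem ZMod.add_one_eq_zero_or_val_add_one {n : ℕ} [NeZero n] (hn : 2 ≤ n) (j : ZMod n) :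
    j + 1 = 0 ∨ (j + 1).val = j.val + 1 := by
  have : Fact (1 < n) := ⟨hn⟩
  rcases Nat.lt_or_ge (j.val + 1) n with h | h
  · right
    rw [ZMod.val_add_of_lt] <;> rw [ZMod.val_one n]
    exact h
  · left
    have hj : j.val + 1 = n := le_antisymm (ZMod.val_lt j) h
    have := congrArg (Nat.cast : ℕ → ZMod n) hj
    simpa using this

theorem mem_cycInterval_zero_of_zero {n : ℕ} [NeZero n] {l : ZMod n} (hl : l ≠ 0) (j : ZMod n) :
    (0 ∈ cycInterval n 0 l ∧ j ∈ cycInterval n 0 l) ∨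
      (0 ∈ cycInterval n l 0 ∧ j ∈ cycInterval n l 0) := by
  rcases le_total j.val l.val with h | h
  · exact Or.inl ⟨by simp [mem_cycInterval_zero_left], mem_cycInterval_zero_left.2 h⟩
  · exact Or.inr ⟨zero_mem_cycInterval_zero_right l, mem_cycInterval_zero_right hl h⟩

theorem mem_cycInterval_zero_of_add_one {n : ℕ} [NeZero n] (hn : 2 ≤ n) {l : ZMod n}
    (hl : l ≠ 0) (j : ZMod n) :
    (j ∈ cycInterval n 0 l ∧ j + 1 ∈ cycInterval n 0 l) ∨
      (j ∈ cycInterval n l 0 ∧ j + 1 ∈ cycInterval n l 0) := by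
  rcases ZMod.add_one_eq_zero_or_val_add_one hn j with h0 | h1
  · rw [h0]
    simpa only [and_comm] using mem_cycInterval_zero_of_zero hl j
  · rcases Nat.lt_or_ge j.val l.val with h | h
    · exact Or.inl ⟨mem_cycInterval_zero_left.2 h.le, mem_cycInterval_zero_left.2 (by omega)⟩
    · exact Or.inr ⟨mem_cycInterval_zero_right hl h, mem_cycInterval_zero_right hl (by omega)⟩

theorem mk_mem_K₀_iff {n : ℕ} [NeZero n] (hn : 2 ≤ n) {i j : ZMod n} :
    s(i, j) ∈ K₀ n ↔ i ≠ j ∧ (i = 0 ∨ j = 0 ∨ j = i + 1 ∨ i = j + 1) := by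
  have : Fact (1 < n) := ⟨hn⟩
  simp only [K₀, mem_union, mem_image, mem_filter, mem_univ, true_and, Sym2.eq_iff]
  constructor
  · rintro (⟨a, ha, ⟨rfl, rfl⟩ | ⟨rfl, rfl⟩⟩ | ⟨a, ⟨rfl, rfl⟩ | ⟨rfl, rfl⟩⟩)
    · exact ⟨ha.symm, Or.inl rfl⟩
    · exact ⟨ha, Or.inr (Or.inl rfl)⟩
    · simp
    · simp
  · rintro ⟨hne, rfl | rfl | rfl | rfl⟩
    · exact Or.inl ⟨j, hne.symm, Or.inl ⟨rfl, rfl⟩⟩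
    · exact Or.inl ⟨i, hne, Or.inr ⟨rfl, rfl⟩⟩
    · exact Or.inr ⟨i, Or.inl ⟨rfl, rfl⟩⟩
    · exact Or.inr ⟨j, Or.inr ⟨rfl, rfl⟩⟩

theorem mem_cycInterval_zero_of_mem_K₀ {n : ℕ} [NeZero n] (hn : 2 ≤ n) {i j l : ZMod n}
    (hl : l ≠ 0) (h : s(i, j) ∈ K₀ n) :
    (i ∈ cycInterval n 0 l ∧ j ∈ cycInterval n 0 l) ∨
      (i ∈ cycInterval n l 0 ∧ j ∈ cycInterval n l 0) := by
  obtain ⟨-, rfl | rfl | rfl | rfl⟩ := (mk_mem_K₀_iff hn).1 h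
  · exact mem_cycInterval_zero_of_zero hl j
  · simpa only [and_comm] using mem_cycInterval_zero_of_zero hl i
  · exact mem_cycInterval_zero_of_add_one hn hl i
  · simpa only [and_comm] using mem_cycInterval_zero_of_add_one hn hl j

theorem not_isDiag_of_mem_K₀ {n : ℕ} [NeZero n] (hn : 2 ≤ n) {p : Sym2 (ZMod n)}
    (hp : p ∈ K₀ n) : ¬ p.IsDiag := by
  induction p with
  | _ i j => exact fun h => ((mk_mem_K₀_iff hn).1 hp).1 (Sym2.mk_isDiag_iff.1 h)

theorem isConfiguration_K₀ {n : ℕ} [NeZero n] (hn : 2 ≤ n) : IsConfiguration n (K₀ n) := by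
  refine ⟨fun p hp => not_isDiag_of_mem_K₀ hn hp, fun i j k l hij hkl => ?_⟩
  obtain ⟨hne, rfl | rfl | rfl | rfl⟩ := (mk_mem_K₀_iff hn).1 hkl
  · exact mem_cycInterval_zero_of_mem_K₀ hn hne.symm hij
  · exact (mem_cycInterval_zero_of_mem_K₀ hn hne hij).symm
  · exact Or.inr ⟨mem_cycInterval_add_one_self _ _, mem_cycInterval_add_one_self _ _⟩
  · exact Or.inl ⟨mem_cycInterval_add_one_self _ _, mem_cycInterval_add_one_self _ _⟩

theorem card_K₀ {n : ℕ} [NeZero n] (hn : 3 ≤ n) : (K₀ n).card = 2 * n - 3 := by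
  have : Fact (1 < n) := ⟨by omega⟩
  have h2 : (1 : ZMod n) + 1 ≠ 0 := by
    intro h
    have h' : ((2 : ℕ) : ZMod n) = 0 := by push_cast; rw [← h]; ring
    have := Nat.le_of_dvd two_pos ((ZMod.natCast_eq_zero_iff 2 n).1 h')
    omega
  have hne : (0 : ZMod n) ≠ -1 := fun h => one_ne_zero (neg_eq_zero.1 h.symm)
  have hK : K₀ n = ((univ \ {0} : Finset (ZMod n)).image fun j => s((0 : ZMod n), j)) ∪
      ((univ \ {0, -1} : Finset (ZMod n)).image fun j => s(j, j + 1)) := by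
    ext p
    simp only [K₀, mem_union, mem_image, mem_filter, mem_sdiff, mem_univ, true_and, mem_insert,
      mem_singleton, not_or]
    constructor
    · rintro (h | ⟨a, rfl⟩)
      · exact Or.inl h
      · by_cases h0 : a = 0
        · exact Or.inl ⟨1, one_ne_zero, by simp [h0]⟩
        · by_cases h1 : a = -1
          · exact Or.inl ⟨a, h0, by simp [h1, Sym2.eq_swap]⟩
          · exact Or.inr ⟨a, ⟨h0, h1⟩, rfl⟩
    · rintro (h | ⟨a, -, rfl⟩)
      · exact Or.inl h
      · exact Or.inr ⟨a, rfl⟩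
  rw [hK, card_union_of_disjoint, card_image_of_injective, card_image_of_injective,
    card_sdiff_of_subset (subset_univ _), card_sdiff_of_subset (subset_univ _), card_univ,
    ZMod.card, card_singleton, card_pair hne]
  · omega
  · intro a b hab
    rcases Sym2.eq_iff.1 hab with ⟨h, -⟩ | ⟨rfl, h⟩
    · exact h
    · exact absurd (by linear_combination h) h2
  · intro a b hab
    exact Sym2.congr_right.1 hab
  · rw [disjoint_left]
    simp only [mem_image, mem_sdiff, mem_univ, true_and, mem_insert, mem_singleton, not_or]
    rintro _ ⟨a, ha, rfl⟩ ⟨b, ⟨hb0, hb1⟩, hb⟩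
    rcases Sym2.eq_iff.1 hb with ⟨h, -⟩ | ⟨-, h⟩
    · exact hb0 h
    · exact hb1 (eq_neg_of_add_eq_zero_left h)

theorem cConfig_eq_two_mul_card {n : ℕ} [NeZero n] {K : Finset (Sym2 (ZMod n))}
    (hK : ∀ p ∈ K, ¬ p.IsDiag) : cConfig n K = 2 * K.card := by
  classical
  obtain ⟨G, hadj⟩ : ∃ G : SimpleGraph (ZMod n), ∀ i j, G.Adj i j ↔ s(i, j) ∈ K := by
    refine ⟨SimpleGraph.fromEdgeSet K, fun i j => ?_⟩
    simp only [SimpleGraph.fromEdgeSet_adj, mem_coe, and_iff_left_iff_imp]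
    exact fun h hij => hK _ h (Sym2.mk_isDiag_iff.2 hij)
  have hcard : G.edgeFinset.card = K.card := by
    congr 1
    ext p
    induction p with
    | _ i j => rw [SimpleGraph.mem_edgeFinset, SimpleGraph.mem_edgeSet, hadj]
  rw [← hcard, ← G.sum_degrees_eq_twice_card_edges, cConfig]
  refine sum_congr rfl fun i _ => ?_
  rw [← SimpleGraph.card_neighborFinset_eq_degree]
  congr 1
  ext j
  simp [hadj]

/-- For `n ≥ 3`, the set `K₀ = {{0,j} : j ≠ 0} ∪ {{j, j+1} : j ∈ ZMod n}` is a
configuration on `ZMod n` with exactly `2n - 3` elements, hence `c_{K₀} = 4n - 6`: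
the bound `c_K ≤ 4n - 6` is attained. -/
theorem config_bound_attained (n : ℕ) [NeZero n] (hn : 3 ≤ n) :
    IsConfiguration n (K₀ n) ∧ (K₀ n).card = 2 * n - 3 ∧ cConfig n (K₀ n) = 4 * n - 6 := by
  have hn2 : 2 ≤ n := by omega
  refine ⟨isConfiguration_K₀ hn2, card_K₀ hn, ?_⟩
  rw [cConfig_eq_two_mul_card fun p hp => not_isDiag_of_mem_K₀ hn2 hp, card_K₀ hn]
  omega
end

section
/- Let p ≥ 1 and let A_p ⊆ ℝ^{2p} be the set of points (t_1, ..., t_{2p}) such that 0 ≤ t_2 ≤ t_4 ≤ ... ≤ t_{2p} and, for every s ∈ {1, ..., p}, 0 ≤ t_{2s−1} ≤ t_{2s}. Then the Lebesgue integral of exp(−(t_1 + t_2 + ... + t_{2p})) over A_p is at most 1/p!. -/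
open MeasureTheory

/-- The region `A_p ⊆ ℝ^{2p}`: points `(t_1, ..., t_{2p})` (here indexed by
`Fin (2p)`, with `t_{j}` for `j ∈ {1, ..., 2p}` corresponding to index `j - 1`) such
that `0 ≤ t_2 ≤ t_4 ≤ ⋯ ≤ t_{2p}` and for every `s ∈ {1, ..., p}`,
`0 ≤ t_{2s-1} ≤ t_{2s}`. -/
def Aregion (p : ℕ) : Set (Fin (2 * p) → ℝ) :=
  {t | (∀ s : Fin p, 0 ≤ t ⟨2 * s.val + 1, by have := s.isLt; omega⟩) ∧
       (∀ s s' : Fin p, s ≤ s' →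
          t ⟨2 * s.val + 1, by have := s.isLt; omega⟩
            ≤ t ⟨2 * s'.val + 1, by have := s'.isLt; omega⟩) ∧
       (∀ s : Fin p, 0 ≤ t ⟨2 * s.val, by have := s.isLt; omega⟩ ∧
          t ⟨2 * s.val, by have := s.isLt; omega⟩
            ≤ t ⟨2 * s.val + 1, by have := s.isLt; omega⟩)}

/-- The permutation of `Fin (2 * p)` which permutes the consecutive pairs `{2 * s, 2 * s + 1}`
according to `σ`. -/
def pairPerm {p : ℕ} (σ : Equiv.Perm (Fin p)) : Equiv.Perm (Fin (2 * p)) :=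
  (finProdFinEquiv.trans (finCongr (mul_comm p 2))).permCongr (σ.prodCongr (Equiv.refl (Fin 2)))

lemma pairPerm_two_mul_add_one {p : ℕ} (σ : Equiv.Perm (Fin p)) (s : Fin p) :
    pairPerm σ ⟨2 * s.val + 1, by lia⟩ = ⟨2 * (σ s).val + 1, by lia⟩ := by
  have h : (⟨2 * s.val + 1, by lia⟩ : Fin (2 * p)) =
      finProdFinEquiv.trans (finCongr (mul_comm p 2)) (s, 1) := by
    ext; simp [add_comm]
  rw [h, pairPerm, Equiv.permCongr_apply, Equiv.symm_apply_apply]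
  ext; simp [add_comm]

lemma measurableSet_Aregion (p : ℕ) : MeasurableSet (Aregion p) := by
  refine IsClosed.measurableSet ?_
  simp only [Aregion, Set.ofPred_and, Set.ofPred_forall]
  refine .inter (isClosed_iInter fun s ↦ ?_) (.inter (isClosed_iInter fun s ↦
    isClosed_iInter fun s' ↦ isClosed_iInter fun _ ↦ ?_) (isClosed_iInter fun s ↦ .inter ?_ ?_))
  all_goals exact isClosed_le (by fun_prop) (by fun_prop)

lemma Aregion_subset_Ici (p : ℕ) : Aregion p ⊆ Set.Ici 0 := by
  rintro t ⟨hodd, -, heven⟩ i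
  rcases Nat.even_or_odd' i.val with ⟨k, hk | hk⟩
  · convert! (heven ⟨k, by lia⟩).1
  · convert! hodd ⟨k, by lia⟩

lemma preimage_pairPerm_subset_Ici {p : ℕ} (σ : Equiv.Perm (Fin p)) :
    (fun t : Fin (2 * p) → ℝ ↦ t ∘ pairPerm σ) ⁻¹' Aregion p ⊆ Set.Ici 0 := by
  intro t ht i
  simpa using Aregion_subset_Ici p ht ((pairPerm σ).symm i)

lemma measurePreserving_comp_equiv {ι : Type*} [Fintype ι] (e : Equiv.Perm ι) :
    MeasurePreserving (fun t : ι → ℝ ↦ t ∘ e) :=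
  (volume_measurePreserving_piCongrLeft (fun _ : ι ↦ ℝ) e).symm

lemma measurableEmbedding_comp_equiv {ι : Type*} (e : Equiv.Perm ι) :
    MeasurableEmbedding (fun t : ι → ℝ ↦ t ∘ e) :=
  (MeasurableEquiv.piCongrLeft (fun _ : ι ↦ ℝ) e).symm.measurableEmbedding

lemma volume_setOf_apply_eq_apply {ι : Type*} [Fintype ι] {i j : ι} (hij : i ≠ j) :
    volume {t : ι → ℝ | t i = t j} = 0 := by
  classical
  let L : (ι → ℝ) →ₗ[ℝ] ℝ :=
    LinearMap.proj (R := ℝ) (φ := fun _ ↦ ℝ) i - LinearMap.proj j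
  have hL : {t : ι → ℝ | t i = t j} = (LinearMap.ker L : Set (ι → ℝ)) := by
    ext t; simp [L, sub_eq_zero]
  rw [hL]
  refine Measure.addHaar_submodule _ _ fun h ↦ ?_
  have hmem : Pi.single i (1 : ℝ) ∈ LinearMap.ker L := h ▸ Submodule.mem_top
  simp [L, hij.symm] at hmem

/-- Almost every point of `ℝ^ι` has pairwise distinct coordinates. -/
lemma ae_injective {ι : Type*} [Fintype ι] : ∀ᵐ t : ι → ℝ, Function.Injective t := by
  have h : ∀ᵐ t : ι → ℝ, ∀ i j, i ≠ j → t i ≠ t j := by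
    simp only [ae_all_iff]
    intro i j hij
    simpa [ae_iff] using volume_setOf_apply_eq_apply hij
  filter_upwards [h] with t ht i j hij
  exact not_imp_not.mp (ht i j) hij

lemma eq_of_injective_of_mem_Aregion {p : ℕ} {σ τ : Equiv.Perm (Fin p)} {t : Fin (2 * p) → ℝ}
    (ht : Function.Injective t) (hσ : t ∘ pairPerm σ ∈ Aregion p)
    (hτ : t ∘ pairPerm τ ∈ Aregion p) : σ = τ := by
  let u : Fin p → ℝ := fun s ↦ t ⟨2 * s.val + 1, by lia⟩
  have hmono {ρ : Equiv.Perm (Fin p)} (hρ : t ∘ pairPerm ρ ∈ Aregion p) : Monotone (u ∘ ρ) := by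
    intro a b hab
    simpa [u, pairPerm_two_mul_add_one] using hρ.2.1 a b hab
  have hu : Function.Injective u := by
    intro a b hab
    have := congrArg Fin.val (ht hab)
    exact Fin.ext (by simpa using this)
  have h := Tuple.unique_monotone (hmono hσ) (hmono hτ)
  exact Equiv.ext fun s ↦ hu (congrFun h s)

lemma aedisjoint_preimage_pairPerm (p : ℕ) :
    Pairwise (Function.onFun (AEDisjoint volume) fun σ : Equiv.Perm (Fin p) ↦
      (fun t : Fin (2 * p) → ℝ ↦ t ∘ pairPerm σ) ⁻¹' Aregion p) := by
  intro σ τ hστ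
  refine measure_mono_null ?_ (ae_iff.mp (ae_injective (ι := Fin (2 * p))))
  rintro t ⟨hσ, hτ⟩ ht
  exact hστ (eq_of_injective_of_mem_Aregion ht hσ hτ)

lemma volume_restrict_Ici_eq_pi (ι : Type*) [Fintype ι] :
    (volume : Measure (ι → ℝ)).restrict (Set.Ici 0) =
      Measure.pi fun _ ↦ volume.restrict (Set.Ici 0) := by
  rw [← Set.pi_univ_Ici, volume_pi, Measure.restrict_pi_pi]
  rfl

lemma integrableOn_exp_neg_sum (ι : Type*) [Fintype ι] :
    IntegrableOn (fun t : ι → ℝ ↦ Real.exp (-∑ i, t i)) (Set.Ici 0) := by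
  rw [IntegrableOn, volume_restrict_Ici_eq_pi]
  simp_rw [← Finset.sum_neg_distrib, Real.exp_sum]
  exact Integrable.fintype_prod (f := fun _ x ↦ Real.exp (-x)) fun _ ↦
    (integrableOn_Ici_iff_integrableOn_Ioi).mpr (integrableOn_exp_neg_Ioi 0)

lemma integral_exp_neg_sum (ι : Type*) [Fintype ι] :
    ∫ t : ι → ℝ in Set.Ici 0, Real.exp (-∑ i, t i) = 1 := by
  rw [volume_restrict_Ici_eq_pi]
  simp_rw [← Finset.sum_neg_distrib, Real.exp_sum]
  rw [integral_fintype_prod_eq_pow (fun x ↦ Real.exp (-x)), integral_Ici_eq_integral_Ioi,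
    integral_exp_neg_Ioi_zero, one_pow]

lemma setIntegral_preimage_pairPerm {p : ℕ} (σ : Equiv.Perm (Fin p)) :
    ∫ t in (fun t : Fin (2 * p) → ℝ ↦ t ∘ pairPerm σ) ⁻¹' Aregion p, Real.exp (-∑ i, t i) =
      ∫ t in Aregion p, Real.exp (-∑ i, t i) := by
  simpa only [Function.comp_apply, Equiv.sum_comp] using
    (measurePreserving_comp_equiv (pairPerm σ)).setIntegral_preimage_emb
      (measurableEmbedding_comp_equiv _) (fun t ↦ Real.exp (-∑ i, t i)) (Aregion p)

/-- For `p ≥ 1`, the Lebesgue integral of `exp(-(t_1 + ⋯ + t_{2p}))` over the region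
`A_p ⊆ ℝ^{2p}` is at most `1/p!`. -/
theorem integral_Aregion_le (p : ℕ) (hp : 1 ≤ p) :
    ∫ t in Aregion p, Real.exp (-∑ i, t i) ≤ 1 / (Nat.factorial p) := by
  have hsub := Set.iUnion_subset (preimage_pairPerm_subset_Ici (p := p))
  have hint := integrableOn_exp_neg_sum (Fin (2 * p))
  have hunion := integral_iUnion_ae (μ := volume)
    (fun σ ↦ ((measurePreserving_comp_equiv (pairPerm σ)).measurable
      (measurableSet_Aregion p)).nullMeasurableSet)
    (aedisjoint_preimage_pairPerm p) (hint.mono_set hsub)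
  simp only [setIntegral_preimage_pairPerm, tsum_fintype, Finset.sum_const, Finset.card_univ,
    Fintype.card_perm, Fintype.card_fin, nsmul_eq_mul] at hunion
  rw [le_div_iff₀' (by positivity), ← hunion, ← integral_exp_neg_sum (Fin (2 * p))]
  exact setIntegral_mono_set hint (.of_forall fun t ↦ (Real.exp_pos _).le) hsub.eventuallyLE
end

section
/- Let A be a unital C*-algebra over ℂ and let τ : A → ℂ be a faithful tracial positive linear functional. If x ∈ A is such that for every y ∈ A the value τ(x · (y* y)) is a nonnegative real number, then x is a nonnegative element of A, i.e., 0 ≤ x in the canonical order on A. -/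
open scoped ComplexOrder

namespace LinearMap

variable {A : Type*} [Ring A] [StarRing A] [Algebra ℂ A] [StarModule ℂ A]

/-- A positive linear functional on a unital star algebra is hermitian. -/
lemma map_star_of_map_star_mul_self_nonneg (τ : A →ₗ[ℂ] ℂ)
    (hpos : ∀ a : A, 0 ≤ τ (star a * a)) (a : A) : τ (star a) = star (τ a) := by
  have him (b : A) : (τ (star b * b)).im = 0 := (Complex.nonneg_iff.mp (hpos b)).2.symm
  have h_one := him 1
  have h_a := him a
  have h_add := him (1 + a)
  have h_add_I := him (1 + Complex.I • a)
  simp only [star_add, star_one, star_smul, add_mul, mul_add, one_mul, mul_one, map_add, map_smul,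
    smul_mul_assoc, mul_smul_comm, Complex.add_im, smul_eq_mul, Complex.mul_im, Complex.mul_re,
    RCLike.star_def, Complex.conj_I, Complex.neg_re, Complex.neg_im, Complex.I_re, Complex.I_im]
    at h_one h_a h_add h_add_I
  apply Complex.ext
  · simp only [RCLike.star_def, Complex.conj_re]
    linarith
  · simp only [RCLike.star_def, Complex.conj_im]
    linarith

/-- A linear functional on a unital star algebra vanishing on all squares `star y * y` is zero. -/
lemma eq_zero_of_map_star_mul_self_eq_zero (φ : A →ₗ[ℂ] ℂ)
    (hφ : ∀ y : A, φ (star y * y) = 0) : φ = 0 := by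
  ext a
  have h_one := hφ 1
  have h_a := hφ a
  have h_add := hφ (1 + a)
  have h_add_I := hφ (1 + Complex.I • a)
  simp only [star_add, star_one, star_smul, add_mul, mul_add, one_mul, mul_one, map_add, map_smul,
    smul_mul_assoc, mul_smul_comm, smul_eq_mul, RCLike.star_def, Complex.conj_I]
    at h_one h_a h_add h_add_I
  have hI := Complex.I_mul_I
  rw [zero_apply]
  linear_combination (1 / 2) * (h_add - h_one - h_a) -
    (Complex.I / 2) * (h_add_I - h_one + Complex.I * Complex.I * h_a) +
    (1 / 2) * (φ a - φ (star a)) * hI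

/-- If `τ` is a faithful positive trace and `τ (x * (star y * y))` is nonnegative for all `y`,
then `x` is selfadjoint. -/
lemma isSelfAdjoint_of_trace_mul_star_mul_nonneg (τ : A →ₗ[ℂ] ℂ)
    (hpos : ∀ a : A, 0 ≤ τ (star a * a))
    (htrace : ∀ a b : A, τ (a * b) = τ (b * a))
    (hfaithful : ∀ a : A, τ (star a * a) = 0 → a = 0)
    {x : A} (hx : ∀ y : A, 0 ≤ τ (x * (star y * y))) : IsSelfAdjoint x := by
  have hzero : τ ∘ₗ LinearMap.mulLeft ℂ (star x - x) = 0 := by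
    refine eq_zero_of_map_star_mul_self_eq_zero _ fun y ↦ ?_
    have hstar : τ (star x * (star y * y)) = star (τ (x * (star y * y))) := by
      rw [← map_star_of_map_star_mul_self_nonneg τ hpos, htrace]
      simp
    rw [comp_apply, mulLeft_apply, sub_mul, map_sub, hstar,
      (IsSelfAdjoint.of_nonneg (hx y)).star_eq, sub_self]
  refine sub_eq_zero.mp (hfaithful _ ?_)
  rw [htrace]
  exact LinearMap.congr_fun hzero (star (star x - x))

end LinearMap

/-- If `τ` is a faithful positive trace on a C⋆-algebra and `τ (x * (star y * y))` is nonnegative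
for all `y`, then `x` is nonnegative. -/
lemma CStarAlgebra.nonneg_of_trace_mul_star_mul_nonneg
    {A : Type*} [CStarAlgebra A] [PartialOrder A] [StarOrderedRing A] (τ : A →ₗ[ℂ] ℂ)
    (hpos : ∀ a : A, 0 ≤ τ (star a * a))
    (htrace : ∀ a b : A, τ (a * b) = τ (b * a))
    (hfaithful : ∀ a : A, τ (star a * a) = 0 → a = 0)
    {x : A} (hx : ∀ y : A, 0 ≤ τ (x * (star y * y))) : 0 ≤ x := by
  have hsa := τ.isSelfAdjoint_of_trace_mul_star_mul_nonneg hpos htrace hfaithful hx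
  have hneg : star x⁻ = x⁻ := (CFC.negPart_nonneg x).isSelfAdjoint.star_eq
  obtain ⟨y, hy⟩ := CStarAlgebra.nonneg_iff_eq_star_mul_self.mp (CFC.negPart_nonneg x)
  have hmul : x * x⁻ = -(star x⁻ * x⁻) := by
    conv_lhs => enter [1]; rw [← CFC.posPart_sub_negPart x hsa]
    rw [sub_mul, CFC.posPart_mul_negPart, zero_sub, hneg]
  have hle : τ (star x⁻ * x⁻) ≤ 0 := by
    have := hx y
    rwa [← hy, hmul, map_neg, Left.nonneg_neg_iff] at this
  exact (CFC.negPart_eq_zero_iff x hsa).mp (hfaithful _ (le_antisymm hle (hpos _)))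

/-- Let `A` be a unital C*-algebra over `ℂ` and `τ : A → ℂ` a faithful tracial
positive linear functional. If `x ∈ A` satisfies `τ(x (y* y)) ≥ 0` (a nonnegative
real, in the partial order of `ℂ`) for every `y ∈ A`, then `x` is a nonnegative
element of `A`, i.e. `x = c* c` for some `c ∈ A` (the canonical order on `A`). -/
theorem nonneg_of_trace_mul_star_mul_nonneg
    {A : Type*} [NormedRing A] [StarRing A] [CStarRing A]
    [NormedAlgebra ℂ A] [CompleteSpace A] [StarModule ℂ A]
    (τ : A →ₗ[ℂ] ℂ)
    (hpos : ∀ a : A, 0 ≤ τ (star a * a))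
    (htrace : ∀ a b : A, τ (a * b) = τ (b * a))
    (hfaithful : ∀ a : A, τ (star a * a) = 0 → a = 0)
    (x : A) (hx : ∀ y : A, 0 ≤ τ (x * (star y * y))) :
    ∃ c : A, x = star c * c := by
  let : CStarAlgebra A := { }
  let := CStarAlgebra.spectralOrder A
  have := CStarAlgebra.spectralOrderedRing A
  exact CStarAlgebra.nonneg_iff_eq_star_mul_self.mp
    (CStarAlgebra.nonneg_of_trace_mul_star_mul_nonneg τ hpos htrace hfaithful hx)
end

section
/- Let A be a nontrivial unital C*-algebra over ℂ and let τ : A → ℂ be a faithful tracial positive linear functional. Then for every x ∈ A: (a) for all y ∈ A, Re τ((xy)* (xy)) ≤ ‖x‖² · Re τ(y* y); and (b) for every real C < ‖x‖² there exists y ∈ A with y ≠ 0 and Re τ((xy)* (xy)) ≥ C · Re τ(y* y). Equivalently, the supremum over y ≠ 0 of τ((xy)*(xy)) / τ(y*y) equals ‖x‖², i.e., the left regular representation of A on L²(A, τ) is isometric. -/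
theorem re_map_real_smul {A : Type*} [AddCommGroup A] [Module ℂ A] {τ : A →ₗ[ℂ] ℂ}
    (r : ℝ) (a : A) : (τ (r • a)).re = r * (τ a).re := by
  rw [← Complex.coe_smul r a, map_smul, smul_eq_mul, Complex.re_ofReal_mul]

section PositiveFunctional

variable {A : Type*} [CStarAlgebra A] [PartialOrder A] [StarOrderedRing A] {τ : A →ₗ[ℂ] ℂ}

theorem re_map_nonneg_of_star_mul_self (hτ : ∀ a : A, 0 ≤ (τ (star a * a)).re) {a : A}
    (ha : 0 ≤ a) : 0 ≤ (τ a).re := by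
  obtain ⟨b, rfl⟩ := CStarAlgebra.nonneg_iff_eq_star_mul_self.mp ha
  exact hτ b

theorem re_map_mono_of_star_mul_self (hτ : ∀ a : A, 0 ≤ (τ (star a * a)).re) {a b : A}
    (hab : a ≤ b) : (τ a).re ≤ (τ b).re := by
  simpa using re_map_nonneg_of_star_mul_self hτ (sub_nonneg.mpr hab)

/-- Left multiplication by `x` has norm at most `‖x‖` on `L²(A, τ)`. -/
theorem re_map_star_mul_mul_le (hτ : ∀ a : A, 0 ≤ (τ (star a * a)).re) (x y : A) :
    (τ (star (x * y) * (x * y))).re ≤ ‖x‖ ^ 2 * (τ (star y * y)).re := by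
  rw [← re_map_real_smul]
  apply re_map_mono_of_star_mul_self hτ
  have h := star_left_conjugate_le_conjugate
    (CStarAlgebra.star_mul_le_algebraMap_norm_sq (a := x)) y
  simpa [Algebra.algebraMap_eq_smul_one, mul_assoc] using h

/-- The positive part of `star x * x - C` is a vector on which left multiplication by `x` almost
attains the norm of `x`. -/
theorem exists_le_re_map_star_mul_mul [Nontrivial A]
    (hτ : ∀ a : A, 0 ≤ (τ (star a * a)).re) (x : A) {C : ℝ} (hC : C < ‖x‖ ^ 2) :
    ∃ y : A, y ≠ 0 ∧ C * (τ (star y * y)).re ≤ (τ (star (x * y) * (x * y))).re := by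
  rcases lt_or_ge C 0 with hneg | hC0
  · refine ⟨1, one_ne_zero, ?_⟩
    exact (mul_nonpos_of_nonpos_of_nonneg hneg.le (hτ 1)).trans (hτ _)
  set b : A := star x * x - algebraMap ℝ A C with hb
  have hbsa : IsSelfAdjoint b :=
    (IsSelfAdjoint.star_mul_self x).sub (IsSelfAdjoint.algebraMap A (IsSelfAdjoint.all C))
  have hsa : star b⁺ = b⁺ := (IsSelfAdjoint.of_nonneg (CFC.posPart_nonneg b)).star_eq
  refine ⟨b⁺, fun h0 ↦ ?_, ?_⟩
  · have hle : b ≤ 0 := by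
      rw [← CFC.posPart_sub_negPart b hbsa, h0, zero_sub, neg_nonpos]
      exact CFC.negPart_nonneg b
    have hnorm := (CStarAlgebra.norm_le_iff_le_algebraMap (star x * x) hC0
      (star_mul_self_nonneg x)).mpr (sub_nonpos.mp hle)
    rw [CStarRing.norm_star_mul_self, ← sq] at hnorm
    exact hC.not_ge hnorm
  · rw [← re_map_real_smul]
    apply re_map_mono_of_star_mul_self hτ
    rw [← sub_nonneg]
    have hconj : star (x * b⁺) * (x * b⁺) - C • (star b⁺ * b⁺) = b⁺ * b⁺ * b⁺ := by
      calc _ = b⁺ * b * b⁺ := by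
            rw [star_mul, hsa]
            nth_rw 6 [hb]
            simp [Algebra.algebraMap_eq_smul_one, mul_sub, sub_mul, mul_assoc]
        _ = _ := by
            nth_rw 2 [← CFC.posPart_sub_negPart b hbsa]
            rw [mul_sub, CFC.posPart_mul_negPart, sub_zero]
    rw [hconj]
    exact conjugate_nonneg_of_nonneg (CFC.posPart_nonneg b) (CFC.posPart_nonneg b)

end PositiveFunctional

/-- Let `A` be a nontrivial unital C*-algebra over `ℂ` and `τ : A → ℂ` a faithful
tracial positive linear functional. Then for every `x ∈ A`:
(a) for all `y`, `Re τ((xy)* (xy)) ≤ ‖x‖² ⬝ Re τ(y* y)`; and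
(b) for every real `C < ‖x‖²` there is `y ≠ 0` with
`C ⬝ Re τ(y* y) ≤ Re τ((xy)* (xy))`.
Equivalently, the left regular representation of `A` on `L²(A, τ)` is isometric. -/
theorem left_regular_representation_isometric
    {A : Type*} [NormedRing A] [StarRing A] [CStarRing A]
    [NormedAlgebra ℂ A] [CompleteSpace A] [StarModule ℂ A] [Nontrivial A]
    (τ : A →ₗ[ℂ] ℂ)
    (hpos : ∀ a : A, 0 ≤ (τ (star a * a)).re ∧ (τ (star a * a)).im = 0)
    (htrace : ∀ a b : A, τ (a * b) = τ (b * a))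
    (hfaithful : ∀ a : A, τ (star a * a) = 0 → a = 0)
    (x : A) :
    (∀ y : A, (τ (star (x * y) * (x * y))).re ≤ ‖x‖ ^ 2 * (τ (star y * y)).re) ∧
    (∀ C : ℝ, C < ‖x‖ ^ 2 →
      ∃ y : A, y ≠ 0 ∧ C * (τ (star y * y)).re ≤ (τ (star (x * y) * (x * y))).re) := by
  let : CStarAlgebra A := {}
  let : PartialOrder A := CStarAlgebra.spectralOrder A
  have : StarOrderedRing A := CStarAlgebra.spectralOrderedRing A
  have hτ (a : A) : 0 ≤ (τ (star a * a)).re := (hpos a).1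
  exact ⟨re_map_star_mul_mul_le hτ x, fun _ hC ↦ exists_le_re_map_star_mul_mul hτ x hC⟩
end
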